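/- Let x(·) = (x_1(·),…,x_N(·)) be a Krasovsky solution of the metric bounded-confidence model ẋ = f^m(x) on [0, +∞). Then x(t) converges as t → +∞ to a cluster point x^∞ = (x_1^∞,…,x_N^∞) ∈ (ℝ^n)^N, i.e., a point such that for all i, j, if ‖x_i^∞ − x_j^∞‖ < 1 then x_i^∞ = x_j^∞. -/

import Mathlib

open MeasureTheory Set Filter
open scoped Pointwise

noncomputable section

/-- The state space of `N` agents with opinions in `ℝ^n`. -/
abbrev St (n N : ℕ) := Fin N → EuclideanSpace ℝ (Fin n)

/-- The Krasovsky multifunction of a vector field `g`: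
`K g (x) = ⋂_{δ>0} closure (convexHull (g '' B(x,δ)))`. -/
def krasovsky {E : Type*} [NormedAddCommGroup E] [NormedSpace ℝ E] (g : E → E) (x : E) :
    Set E :=
  ⋂ δ > (0:ℝ), closure (convexHull ℝ (g '' Metric.ball x δ))

/-- Krasovsky solution of `ẋ = g(x)` on the set `D`: an absolutely continuous curve
(written in integral form) whose a.e. derivative `v` satisfies `v(s) ∈ K g (x(s))`. -/
def IsKrasovskySolutionOn {E : Type*} [NormedAddCommGroup E] [NormedSpace ℝ E]
    [CompleteSpace E] (g : E → E) (x : ℝ → E) (D : Set ℝ) : Prop :=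
  ∃ v : ℝ → E, LocallyIntegrableOn v D ∧
    (∀ t ∈ D, x t = x 0 + ∫ s in Ioc (0:ℝ) t, v s) ∧
    (∀ᵐ s ∂(volume.restrict D), v s ∈ krasovsky g (x s))

/-- The metric bounded-confidence vector field:
`fᵐᵢ(x) = Σ_{j : ‖x_j - x_i‖ < 1} a(‖x_j - x_i‖)(x_j - x_i)`. -/
def fm {n N : ℕ} (a : ℝ → ℝ) (x : St n N) : St n N :=
  fun i => ∑ j ∈ Finset.univ.filter (fun j => ‖x j - x i‖ < 1),
    a ‖x j - x i‖ • (x j - x i)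

theorem mem_of_mem_krasovsky {E : Type*} [NormedAddCommGroup E] [NormedSpace ℝ E] {g : E → E}
    {x v : E} {S : Set E} {δ : ℝ} (hv : v ∈ krasovsky g x) (hδ : 0 < δ) (hS : IsClosed S)
    (hc : Convex ℝ S) (h : ∀ y ∈ Metric.ball x δ, g y ∈ S) : v ∈ S := by
  have h1 : v ∈ closure (convexHull ℝ (g '' Metric.ball x δ)) := by
    have := hv
    simp only [krasovsky, mem_iInter] at this
    exact this δ hδ
  refine closure_minimal (convexHull_min ?_ hc) hS h1
  rintro _ ⟨y, hy, rfl⟩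
  exact h y hy

/-- The interaction weight between agents `i` and `j` at the configuration `y`. -/
def weight {n N : ℕ} (a : ℝ → ℝ) (y : St n N) (i j : Fin N) : ℝ :=
  if ‖y j - y i‖ < 1 then a ‖y j - y i‖ else 0

/-- The quadratic pairing `∑ᵢ ⟪yᵢ, vᵢ⟫` on the state space. -/
def pairing {n N : ℕ} (y v : St n N) : ℝ := ∑ i, inner ℝ (y i) (v i)

/-- The observable `2 ∑ᵢ ‖zᵢ‖² + ⟪u, ∑_{j ∈ C} zⱼ⟫`. -/
def observable {n N : ℕ} (C : Finset (Fin N)) (u : EuclideanSpace ℝ (Fin n)) (z : St n N) : ℝ :=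
  2 * ∑ i, ‖z i‖ ^ 2 + inner ℝ u (∑ j ∈ C, z j)

section Field

variable {n N : ℕ} {a : ℝ → ℝ}

theorem weight_symm (y : St n N) (i j : Fin N) : weight a y i j = weight a y j i := by
  simp only [weight, norm_sub_rev (y j) (y i)]

theorem weight_nonneg (ha : ∀ r : ℝ, 0 ≤ r → 0 ≤ a r) (y : St n N) (i j : Fin N) :
    0 ≤ weight a y i j := by
  unfold weight
  split_ifs
  · exact ha _ (norm_nonneg _)
  · exact le_rfl

theorem fm_apply (y : St n N) (i : Fin N) : fm a y i = ∑ j, weight a y i j • (y j - y i) := by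
  simp only [fm, weight, Finset.sum_filter, ite_smul, zero_smul]

theorem norm_fm_le (ha : ∀ r : ℝ, 0 ≤ r → 0 ≤ a r) (hmono : MonotoneOn a (Ici 0)) (y : St n N) :
    ‖fm a y‖ ≤ N * a 1 := by
  have h1 : 0 ≤ a 1 := ha 1 zero_le_one
  refine (pi_norm_le_iff_of_nonneg (by positivity)).2 fun i => ?_
  rw [fm_apply]
  refine (norm_sum_le _ _).trans ?_
  have : ∀ j ∈ (Finset.univ : Finset (Fin N)), ‖weight a y i j • (y j - y i)‖ ≤ a 1 := by
    intro j _
    rw [norm_smul, Real.norm_of_nonneg (weight_nonneg ha y i j)]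
    unfold weight
    split_ifs with h
    · have h2 := hmono (norm_nonneg (y j - y i)) (mem_Ici.2 zero_le_one) h.le
      have h3 := ha _ (norm_nonneg (y j - y i))
      nlinarith [norm_nonneg (y j - y i)]
    · simpa using h1
  simpa using Finset.sum_le_card_nsmul _ _ _ this

theorem pairing_fm (y : St n N) :
    2 * pairing y (fm a y) = -∑ i, ∑ j, weight a y i j * ‖y j - y i‖ ^ 2 := by
  have h1 : pairing y (fm a y) = ∑ i, ∑ j, weight a y i j * inner ℝ (y i) (y j - y i) := by
    simp only [pairing, fm_apply, inner_sum, inner_smul_right]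
  have h2 : pairing y (fm a y) = ∑ i, ∑ j, weight a y i j * inner ℝ (y j) (y i - y j) := by
    rw [h1, Finset.sum_comm]
    refine Finset.sum_congr rfl fun i _ => Finset.sum_congr rfl fun j _ => ?_
    rw [weight_symm]
  rw [two_mul]
  nth_rewrite 1 [h1]
  rw [h2, ← Finset.sum_add_distrib, ← Finset.sum_neg_distrib]
  refine Finset.sum_congr rfl fun i _ => ?_
  rw [← Finset.sum_add_distrib, ← Finset.sum_neg_distrib]
  refine Finset.sum_congr rfl fun j _ => ?_
  rw [← real_inner_self_eq_norm_sq]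
  simp only [inner_sub_left, inner_sub_right, real_inner_comm (y i) (y j)]
  ring

theorem pairing_fm_le (ha : ∀ r : ℝ, 0 ≤ r → 0 ≤ a r) (y : St n N) (i j : Fin N) :
    2 * pairing y (fm a y) ≤ -(weight a y i j * ‖y j - y i‖ ^ 2) := by
  rw [pairing_fm]
  have h0 : ∀ i j, 0 ≤ weight a y i j * ‖y j - y i‖ ^ 2 := fun i j =>
    mul_nonneg (weight_nonneg ha y i j) (sq_nonneg _)
  have h1 := Finset.single_le_sum (f := fun j => weight a y i j * ‖y j - y i‖ ^ 2)
    (fun j _ => h0 i j) (Finset.mem_univ j)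
  have h2 := Finset.single_le_sum (f := fun i => ∑ j, weight a y i j * ‖y j - y i‖ ^ 2)
    (fun i _ => Finset.sum_nonneg fun j _ => h0 i j) (Finset.mem_univ i)
  linarith

theorem sum_fm_eq (y : St n N) (C : Finset (Fin N)) :
    ∑ i ∈ C, fm a y i = ∑ i ∈ C, ∑ j ∈ Cᶜ, weight a y i j • (y j - y i) := by
  have h0 : ∑ i ∈ C, ∑ j ∈ C, weight a y i j • (y j - y i) = 0 := by
    have h : ∑ i ∈ C, ∑ j ∈ C, weight a y i j • (y j - y i)
        = -∑ i ∈ C, ∑ j ∈ C, weight a y i j • (y j - y i) := by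
      conv_lhs => rw [Finset.sum_comm]
      rw [← Finset.sum_neg_distrib]
      refine Finset.sum_congr rfl fun i _ => ?_
      rw [← Finset.sum_neg_distrib]
      refine Finset.sum_congr rfl fun j _ => ?_
      rw [weight_symm, ← smul_neg, neg_sub]
    rw [eq_neg_iff_add_eq_zero, ← two_smul ℝ] at h
    exact (smul_eq_zero.1 h).resolve_left two_ne_zero
  simp only [fm_apply]
  rw [← zero_add (∑ i ∈ C, ∑ j ∈ Cᶜ, weight a y i j • (y j - y i)), ← h0,
    ← Finset.sum_add_distrib]
  exact Finset.sum_congr rfl fun i _ => (Finset.sum_add_sum_compl C _).symm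

theorem inner_sum_fm_add_pairing_nonpos (ha : ∀ r : ℝ, 0 ≤ r → 0 ≤ a r) (y : St n N)
    (C : Finset (Fin N)) (hC : ∀ i ∈ C, ∀ j ∉ C, 1 / 2 ≤ ‖y j - y i‖)
    {u : EuclideanSpace ℝ (Fin n)} (hu : ‖u‖ ≤ 1) :
    inner ℝ u (∑ i ∈ C, fm a y i) + 4 * pairing y (fm a y) ≤ 0 := by
  have h0 : ∀ i j, 0 ≤ weight a y i j * ‖y j - y i‖ ^ 2 := fun i j =>
    mul_nonneg (weight_nonneg ha y i j) (sq_nonneg _)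
  have h1 : inner ℝ u (∑ i ∈ C, fm a y i) ≤ ‖∑ i ∈ C, fm a y i‖ :=
    (real_inner_le_norm _ _).trans (mul_le_of_le_one_left (norm_nonneg _) hu)
  have h2 : ‖∑ i ∈ C, fm a y i‖ ≤ ∑ i ∈ C, ∑ j ∈ Cᶜ, 2 * (weight a y i j * ‖y j - y i‖ ^ 2) := by
    rw [sum_fm_eq]
    refine (norm_sum_le _ _).trans (Finset.sum_le_sum fun i hi => ?_)
    refine (norm_sum_le _ _).trans (Finset.sum_le_sum fun j hj => ?_)
    rw [norm_smul, Real.norm_of_nonneg (weight_nonneg ha y i j)]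
    have h3 := hC i hi j (Finset.mem_compl.1 hj)
    have h4 := weight_nonneg ha y i j
    have h5 : ‖y j - y i‖ ≤ 2 * ‖y j - y i‖ ^ 2 := by nlinarith
    nlinarith [mul_le_mul_of_nonneg_left h5 h4]
  have h3 : ∑ i ∈ C, ∑ j ∈ Cᶜ, 2 * (weight a y i j * ‖y j - y i‖ ^ 2)
      ≤ ∑ i, ∑ j, 2 * (weight a y i j * ‖y j - y i‖ ^ 2) := by
    refine (Finset.sum_le_sum fun i _ => ?_).trans
      (Finset.sum_le_sum_of_subset_of_nonneg (Finset.subset_univ C) fun i _ _ => ?_)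
    · exact Finset.sum_le_sum_of_subset_of_nonneg (Finset.subset_univ _)
        fun j _ _ => by linarith [h0 i j]
    · exact Finset.sum_nonneg fun j _ => by linarith [h0 i j]
  have h4 := pairing_fm (a := a) y
  simp only [← Finset.mul_sum] at h3
  simp only [← Finset.mul_sum] at h2
  linarith

theorem pairing_le (w v : St n N) : pairing w v ≤ N * (‖w‖ * ‖v‖) := by
  have : ∀ i ∈ (Finset.univ : Finset (Fin N)), inner ℝ (w i) (v i) ≤ ‖w‖ * ‖v‖ := fun i _ =>
    (real_inner_le_norm _ _).trans
      (mul_le_mul (norm_le_pi_norm w i) (norm_le_pi_norm v i) (norm_nonneg _) (norm_nonneg _))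
  simpa [pairing] using Finset.sum_le_card_nsmul _ _ _ this

theorem inner_sum_add_pairing_le_of_mem_krasovsky (ha : ∀ r : ℝ, 0 ≤ r → 0 ≤ a r)
    (hmono : MonotoneOn a (Ici 0)) {x v : St n N} (hv : v ∈ krasovsky (fm a) x)
    (C : Finset (Fin N)) (u : EuclideanSpace ℝ (Fin n)) {c δ : ℝ} (hδ : 0 < δ)
    (h : ∀ y ∈ Metric.ball x δ, inner ℝ u (∑ i ∈ C, fm a y i) + 4 * pairing y (fm a y) ≤ c) :
    inner ℝ u (∑ i ∈ C, v i) + 4 * pairing x v ≤ c := by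
  refine le_of_forall_pos_le_add fun ε hε => ?_
  have h1 : 0 ≤ a 1 := ha 1 zero_le_one
  set M : ℝ := 4 * (N * (N * a 1)) with hM
  have hM0 : 0 ≤ M := by positivity
  obtain ⟨η, hη, hηε⟩ : ∃ η > 0, M * η ≤ ε := by
    refine ⟨ε / (M + 1), by positivity, ?_⟩
    rw [mul_div_assoc', div_le_iff₀ (by positivity)]
    nlinarith
  let S : Set (St n N) := {w | inner ℝ u (∑ i ∈ C, w i) + 4 * pairing x w ≤ c + ε}
  have hlin : IsLinearMap ℝ fun w : St n N => inner ℝ u (∑ i ∈ C, w i) + 4 * pairing x w := by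
    constructor
    · intro w z
      simp only [pairing, Pi.add_apply, Finset.sum_add_distrib, inner_add_right]
      ring
    · intro r w
      simp only [pairing, Pi.smul_apply, ← Finset.smul_sum, inner_smul_right, smul_eq_mul,
        ← Finset.mul_sum]
      ring
  have hcont : Continuous fun w : St n N => inner ℝ u (∑ i ∈ C, w i) + 4 * pairing x w := by
    unfold pairing
    fun_prop
  refine mem_of_mem_krasovsky (S := S) hv (lt_min hδ hη)
    (isClosed_le hcont continuous_const) (convex_halfSpace_le hlin _) fun y hy => ?_
  have hy1 := h y (Metric.ball_subset_ball (min_le_left _ _) hy)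
  have hy2 : ‖x - y‖ ≤ η := by
    rw [← dist_eq_norm, dist_comm]
    exact (Metric.mem_ball.1 (Metric.ball_subset_ball (min_le_right _ _) hy)).le
  have h2 : pairing x (fm a y) = pairing y (fm a y) + pairing (x - y) (fm a y) := by
    simp only [pairing, ← Finset.sum_add_distrib, Pi.sub_apply, inner_sub_left]
    exact Finset.sum_congr rfl fun i _ => by ring
  have h3 : pairing (x - y) (fm a y) ≤ N * (η * (N * a 1)) := by
    refine (pairing_le _ _).trans (mul_le_mul_of_nonneg_left ?_ (Nat.cast_nonneg _))
    exact mul_le_mul hy2 (norm_fm_le ha hmono y) (norm_nonneg _) hη.le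
  change inner ℝ u (∑ i ∈ C, fm a y i) + 4 * pairing x (fm a y) ≤ c + ε
  have h4 : 4 * (N * (η * (N * a 1))) = M * η := by rw [hM]; ring
  linarith

theorem norm_le_of_mem_krasovsky (ha : ∀ r : ℝ, 0 ≤ r → 0 ≤ a r)
    (hmono : MonotoneOn a (Ici 0)) {x v : St n N} (hv : v ∈ krasovsky (fm a) x) :
    ‖v‖ ≤ N * a 1 := by
  have := mem_of_mem_krasovsky (S := Metric.closedBall 0 (N * a 1)) hv one_pos
    Metric.isClosed_closedBall (convex_closedBall _ _)
    fun y _ => by simpa using norm_fm_le ha hmono y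
  simpa using this

end Field

section Dynamics

variable {n N : ℕ} {a : ℝ → ℝ}

theorem contDiff_observable (C : Finset (Fin N)) (u : EuclideanSpace ℝ (Fin n)) :
    ContDiff ℝ 1 (observable (N := N) C u) := by
  unfold observable
  have h : ∀ i, ContDiff ℝ 1 fun z : St n N => z i := fun i => contDiff_apply ℝ _ i
  exact (contDiff_const.mul (ContDiff.sum fun i _ => (h i).norm_sq ℝ)).add
    (contDiff_const.inner ℝ (ContDiff.sum fun i _ => h i))

theorem hasDerivAt_observable (C : Finset (Fin N)) (u : EuclideanSpace ℝ (Fin n))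
    {x : ℝ → St n N} {v : St n N} {t : ℝ} (hx : HasDerivAt x v t) :
    HasDerivAt (fun t => observable C u (x t)) (inner ℝ u (∑ i ∈ C, v i) + 4 * pairing (x t) v)
      t := by
  have h : ∀ i, HasDerivAt (fun t => x t i) (v i) t := hasDerivAt_pi.1 hx
  have h1 : HasDerivAt (fun t => ∑ i, ‖x t i‖ ^ 2) (∑ i, 2 * inner ℝ (x t i) (v i)) t :=
    HasDerivAt.fun_sum fun i _ => (h i).norm_sq
  have h2 : HasDerivAt (fun t => ∑ j ∈ C, x t j) (∑ j ∈ C, v j) t :=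
    HasDerivAt.fun_sum fun i _ => h i
  have h3 := (h1.const_mul 2).add ((hasDerivAt_const t u).inner ℝ h2)
  convert! h3 using 1
  simp only [pairing, ← Finset.mul_sum, inner_zero_left]
  ring

theorem sub_le_of_ae_deriv_le {h : ℝ → ℝ} {s t c : ℝ} (hst : s ≤ t)
    (hac : AbsolutelyContinuousOnInterval h s t)
    (hd : ∀ᵐ τ, τ ∈ Ioc s t → deriv h τ ≤ c) : h t - h s ≤ c * (t - s) := by
  rw [← hac.integral_deriv_eq_sub]
  have h1 : ∫ τ in s..t, deriv h τ ≤ ∫ _ in s..t, c := by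
    refine intervalIntegral.integral_mono_ae_restrict hst hac.intervalIntegrable_deriv (by simp) ?_
    rw [EventuallyLE, Measure.restrict_congr_set Ioc_ae_eq_Icc.symm,
      ae_restrict_iff' measurableSet_Ioc]
    exact hd
  simpa [mul_comm] using h1

/-- A globally Lipschitz curve which is almost everywhere differentiable with derivative in the
Krasovsky multifunction. -/
structure IsLipschitzSolution (a : ℝ → ℝ) (x : ℝ → St n N) : Prop where
  norm_sub_le : ∀ s t, 0 ≤ s → s ≤ t → ‖x t - x s‖ ≤ N * a 1 * (t - s)
  ae_hasDerivAt : ∀ᵐ τ, 0 < τ → ∃ v ∈ krasovsky (fm a) (x τ), HasDerivAt x v τ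

theorem IsKrasovskySolutionOn.isLipschitzSolution (ha : ∀ r : ℝ, 0 ≤ r → 0 ≤ a r)
    (hmono : MonotoneOn a (Ici 0)) {x : ℝ → St n N}
    (hx : IsKrasovskySolutionOn (fm a) x (Ici 0)) : IsLipschitzSolution a x := by
  obtain ⟨v, hv, hxv, hK⟩ := hx
  rw [ae_restrict_iff' measurableSet_Ici] at hK
  have hint : ∀ s t, 0 ≤ s → 0 ≤ t → IntervalIntegrable v volume s t := fun s t hs ht => by
    rw [intervalIntegrable_iff']
    refine hv.integrableOn_compact_subset ?_ isCompact_uIcc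
    exact (convex_Ici (0 : ℝ)).ordConnected.uIcc_subset hs ht
  have hxv' : ∀ t, 0 ≤ t → x t = x 0 + ∫ s in (0 : ℝ)..t, v s := fun t ht => by
    rw [intervalIntegral.integral_of_le ht]
    exact hxv t ht
  refine ⟨fun s t hs hst => ?_, ?_⟩
  · have ht := hs.trans hst
    have h1 : x t - x s = ∫ τ in s..t, v τ := by
      rw [hxv' t ht, hxv' s hs, add_sub_add_left_eq_sub,
        intervalIntegral.integral_interval_sub_left (hint 0 t le_rfl ht) (hint 0 s le_rfl hs)]
    rw [h1, ← abs_of_nonneg (sub_nonneg.2 hst)]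
    refine intervalIntegral.norm_integral_le_of_norm_le_const_ae ?_
    filter_upwards [hK] with τ hτ hτ'
    rw [uIoc_of_le hst] at hτ'
    exact norm_le_of_mem_krasovsky ha hmono (hτ (hs.trans hτ'.1.le))
  · have h1 : ∀ m : ℕ, ∀ᵐ τ, τ ∈ uIcc (0 : ℝ) m → ∀ c ∈ uIcc (0 : ℝ) m,
        HasDerivAt (fun x => ∫ t in c..x, v t) (v τ) τ := fun m =>
      (hint 0 m le_rfl (Nat.cast_nonneg m)).ae_hasDerivAt_integral
    filter_upwards [ae_all_iff.2 h1, hK] with τ hτ hτK hτ0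
    refine ⟨v τ, hτK hτ0.le, ?_⟩
    obtain ⟨m, hm⟩ := exists_nat_ge τ
    have h2 := hτ m (by rw [uIcc_of_le (Nat.cast_nonneg m)]; exact ⟨hτ0.le, hm⟩) 0 left_mem_uIcc
    refine (h2.const_add (x 0)).congr_of_eventuallyEq ?_
    filter_upwards [lt_mem_nhds hτ0] with r hr
    exact hxv' r hr.le

theorem IsLipschitzSolution.lipschitzOnWith (ha : ∀ r : ℝ, 0 ≤ r → 0 ≤ a r)
    {x : ℝ → St n N} (hx : IsLipschitzSolution a x) :
    LipschitzOnWith (N * a 1).toNNReal x (Ici 0) := by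
  have h1 : 0 ≤ a 1 := ha 1 zero_le_one
  have hM : 0 ≤ N * a 1 := by positivity
  refine LipschitzOnWith.of_dist_le_mul fun p hp q hq => ?_
  rw [Real.coe_toNNReal _ hM]
  rcases le_total p q with hpq | hpq
  · rw [dist_comm, dist_eq_norm, dist_comm, Real.dist_eq, abs_of_nonneg (sub_nonneg.2 hpq)]
    exact hx.norm_sub_le _ _ hp hpq
  · rw [dist_eq_norm, Real.dist_eq, abs_of_nonneg (sub_nonneg.2 hpq)]
    exact hx.norm_sub_le _ _ hq hpq

theorem IsLipschitzSolution.observable_le (ha : ∀ r : ℝ, 0 ≤ r → 0 ≤ a r)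
    (hmono : MonotoneOn a (Ici 0)) {x : ℝ → St n N} (hx : IsLipschitzSolution a x)
    (C : Finset (Fin N)) (u : EuclideanSpace ℝ (Fin n)) {s t c : ℝ} (hs : 0 ≤ s) (hst : s ≤ t)
    (h : ∀ τ ∈ Ioc s t, ∃ δ > 0, ∀ y ∈ Metric.ball (x τ) δ,
      inner ℝ u (∑ i ∈ C, fm a y i) + 4 * pairing y (fm a y) ≤ c) :
    observable C u (x t) - observable C u (x s) ≤ c * (t - s) := by
  have hL := (hx.lipschitzOnWith ha).mono (s := uIcc s t)
    ((convex_Ici (0 : ℝ)).ordConnected.uIcc_subset hs (hs.trans hst))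
  have hbdd := (isCompact_uIcc.image_of_continuousOn hL.continuousOn).isBounded
  obtain ⟨R, hR⟩ := hbdd.subset_closedBall (0 : St n N)
  obtain ⟨K, hK⟩ := (contDiff_observable C u).contDiffOn.exists_lipschitzOnWith one_ne_zero
    (convex_closedBall (0 : St n N) R) (isCompact_closedBall _ _)
  refine sub_le_of_ae_deriv_le hst
    (hK.comp hL (mapsTo_iff_image_subset.2 hR)).absolutelyContinuousOnInterval ?_
  filter_upwards [hx.ae_hasDerivAt] with τ hτ hτst
  obtain ⟨v, hv, hxv⟩ := hτ (hs.trans_lt hτst.1)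
  obtain ⟨δ, hδ, hy⟩ := h τ hτst
  have := (hasDerivAt_observable C u hxv).deriv
  exact this.trans_le (inner_sum_add_pairing_le_of_mem_krasovsky ha hmono hv C u hδ hy)

end Dynamics

section Asymptotics

variable {n N : ℕ} {a : ℝ → ℝ} {x : ℝ → St n N}

theorem abs_norm_sub_sub_norm_sub_le (y z : St n N) (i j : Fin N) :
    |‖y j - y i‖ - ‖z j - z i‖| ≤ 2 * ‖y - z‖ := by
  refine (abs_norm_sub_norm_le _ _).trans ?_
  have h : y j - y i - (z j - z i) = (y - z) j - (y - z) i := by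
    simp only [Pi.sub_apply]
    abel
  rw [h]
  linarith [norm_sub_le ((y - z) j) ((y - z) i), norm_le_pi_norm (y - z) i,
    norm_le_pi_norm (y - z) j]

/-- Twice the second moment of a configuration, a Lyapunov function of the dynamics. -/
def lyapunov (z : St n N) : ℝ := 2 * ∑ i, ‖z i‖ ^ 2

theorem observable_empty (z : St n N) : observable ∅ 0 z = lyapunov z := by
  simp [observable, lyapunov]

theorem lyapunov_nonneg (z : St n N) : 0 ≤ lyapunov z := by
  unfold lyapunov
  positivity

theorem IsLipschitzSolution.lyapunov_antitoneOn (ha : ∀ r : ℝ, 0 ≤ r → 0 ≤ a r)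
    (hmono : MonotoneOn a (Ici 0)) (hx : IsLipschitzSolution a x) :
    AntitoneOn (fun t => lyapunov (x t)) (Ici 0) := by
  intro s hs t _ hst
  have := hx.observable_le ha hmono ∅ 0 (c := 0) hs hst fun τ _ => ⟨1, one_pos, fun y _ =>
    inner_sum_fm_add_pairing_nonpos ha y ∅ (by simp) (by simp)⟩
  simp only [observable_empty] at this
  simp only
  linarith

theorem IsLipschitzSolution.exists_lyapunov_sub_lt (ha : ∀ r : ℝ, 0 ≤ r → 0 ≤ a r)
    (hmono : MonotoneOn a (Ici 0)) (hx : IsLipschitzSolution a x) {ε : ℝ} (hε : 0 < ε) :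
    ∃ T, 0 ≤ T ∧ ∀ s t, T ≤ s → s ≤ t → lyapunov (x s) - lyapunov (x t) < ε := by
  set W : Set ℝ := (fun t => lyapunov (x t)) '' Ici 0
  have hW : BddBelow W := ⟨0, by rintro _ ⟨t, _, rfl⟩; exact lyapunov_nonneg _⟩
  have hne : W.Nonempty := ⟨_, 0, self_mem_Ici, rfl⟩
  obtain ⟨_, ⟨T, hT, rfl⟩, hlt⟩ := exists_lt_of_csInf_lt hne (lt_add_of_pos_right (sInf W) hε)
  rw [mem_Ici] at hT
  refine ⟨T, hT, fun s t hs hst => ?_⟩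
  have h1 := hx.lyapunov_antitoneOn ha hmono hT (hT.trans hs) hs
  have h2 : sInf W ≤ lyapunov (x t) := csInf_le hW ⟨t, hT.trans (hs.trans hst), rfl⟩
  simp only at h1 hlt
  linarith

theorem IsLipschitzSolution.exists_forall_dist_lt_or_lt (ha : ∀ r : ℝ, 0 ≤ r → 0 ≤ a r)
    (hpos : ∀ r : ℝ, 0 < r → 0 < a r) (hmono : MonotoneOn a (Ici 0))
    (hx : IsLipschitzSolution a x) {δ : ℝ} (hδ : 0 < δ) :
    ∃ T, 0 ≤ T ∧ ∀ t, T ≤ t → ∀ i j, ‖x t j - x t i‖ < δ ∨ 1 - δ < ‖x t j - x t i‖ := by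
  have h1 : 0 ≤ a 1 := ha 1 zero_le_one
  have hM : 0 ≤ N * a 1 := by positivity
  set h : ℝ := δ / (4 * (N * a 1 + 1)) with hh
  have hhpos : 0 < h := by positivity
  have hMh : N * a 1 * h ≤ δ / 4 := by
    rw [hh, mul_div_assoc', div_le_iff₀ (by positivity)]
    nlinarith
  set κ : ℝ := 2 * (a (δ / 4) * (δ / 4) ^ 2) with hκ
  have hκpos : 0 < κ := by
    have := hpos (δ / 4) (by positivity)
    positivity
  obtain ⟨T, hT, hVT⟩ := hx.exists_lyapunov_sub_lt ha hmono (mul_pos hκpos hhpos)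
  refine ⟨T, hT, fun t ht i j => ?_⟩
  by_contra! hcon
  have hle : t ≤ t + h := by linarith
  have hobs := hx.observable_le ha hmono ∅ 0 (c := -κ) (hT.trans ht) hle fun τ hτ => by
    refine ⟨δ / 8, by positivity, fun y hy => ?_⟩
    have hd1 := abs_le.1 (abs_norm_sub_sub_norm_sub_le y (x τ) i j)
    have hd2 := abs_le.1 (abs_norm_sub_sub_norm_sub_le (x τ) (x t) i j)
    have hd3 : ‖y - x τ‖ < δ / 8 := by rwa [← dist_eq_norm]
    have hd4 := hx.norm_sub_le t τ (hT.trans ht) hτ.1.le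
    have hd5 : N * a 1 * (τ - t) ≤ N * a 1 * h :=
      mul_le_mul_of_nonneg_left (by linarith [hτ.2]) hM
    have hlow : δ / 4 ≤ ‖y j - y i‖ := by linarith [hcon.1]
    have hup : ‖y j - y i‖ < 1 := by linarith [hcon.2]
    have hp := pairing_fm_le ha y i j
    rw [weight, if_pos hup] at hp
    have ha' : a (δ / 4) ≤ a ‖y j - y i‖ :=
      hmono (mem_Ici.2 (by positivity)) (norm_nonneg _) hlow
    have hm : a (δ / 4) * (δ / 4) ^ 2 ≤ a ‖y j - y i‖ * ‖y j - y i‖ ^ 2 :=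
      mul_le_mul ha' (pow_le_pow_left₀ (by positivity) hlow 2) (by positivity)
        (ha _ (norm_nonneg _))
    simp only [inner_zero_left, zero_add]
    linarith
  simp only [observable_empty] at hobs
  have := hVT t (t + h) ht hle
  rw [add_sub_cancel_left] at hobs
  linarith

theorem lt_of_dichotomy {φ : ℝ → ℝ} {T p q : ℝ} (hφ : ContinuousOn φ (Ici T)) (hpq : p ≤ q)
    (h : ∀ t, T ≤ t → φ t < p ∨ q < φ t) {s t : ℝ} (hs : T ≤ s) (ht : T ≤ t) (hsp : φ s < p) :
    φ t < p := by
  refine (h t ht).resolve_right fun hq => ?_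
  obtain ⟨r, hr, hrp⟩ := isPreconnected_Ici.intermediate_value hs ht hφ
    (show p ∈ Icc (φ s) (φ t) from ⟨hsp.le, hpq.trans hq.le⟩)
  rcases h r hr with h1 | h1 <;> linarith

theorem IsLipschitzSolution.norm_sum_sub_le (ha : ∀ r : ℝ, 0 ≤ r → 0 ≤ a r)
    (hmono : MonotoneOn a (Ici 0)) (hx : IsLipschitzSolution a x) (C : Finset (Fin N)) {s t : ℝ}
    (hs : 0 ≤ s) (hst : s ≤ t)
    (hC : ∀ τ ∈ Ioc s t, ∀ i ∈ C, ∀ j ∉ C, 3 / 4 ≤ ‖x τ j - x τ i‖) :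
    ‖∑ i ∈ C, x t i - ∑ i ∈ C, x s i‖ ≤ lyapunov (x s) - lyapunov (x t) := by
  set d := ∑ i ∈ C, x t i - ∑ i ∈ C, x s i with hd
  have hu : ‖‖d‖⁻¹ • d‖ ≤ 1 := by
    rw [norm_smul, norm_inv, norm_norm]
    exact inv_mul_le_one
  have := hx.observable_le ha hmono C (‖d‖⁻¹ • d) (c := 0) hs hst fun τ hτ => by
    refine ⟨1 / 8, by norm_num, fun y hy => inner_sum_fm_add_pairing_nonpos ha y C ?_ hu⟩
    intro i hi j hj
    have hd1 := abs_le.1 (abs_norm_sub_sub_norm_sub_le y (x τ) i j)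
    have hd3 : ‖y - x τ‖ < 1 / 8 := by rwa [← dist_eq_norm]
    linarith [hC τ hτ i hi j hj]
  have hin : inner ℝ (‖d‖⁻¹ • d) (∑ i ∈ C, x t i) - inner ℝ (‖d‖⁻¹ • d) (∑ i ∈ C, x s i) = ‖d‖ := by
    rw [← inner_sub_right, ← hd, real_inner_smul_left, real_inner_self_eq_norm_sq]
    rcases eq_or_ne ‖d‖ 0 with h0 | h0
    · simp [h0]
    · field_simp
  simp only [observable] at this
  simp only [lyapunov]
  linarith

theorem IsLipschitzSolution.exists_tendsto (ha : ∀ r : ℝ, 0 ≤ r → 0 ≤ a r)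
    (hpos : ∀ r : ℝ, 0 < r → 0 < a r) (hmono : MonotoneOn a (Ici 0))
    (hx : IsLipschitzSolution a x) :
    ∃ xlim : St n N, Tendsto x atTop (nhds xlim) ∧
      ∀ i j : Fin N, ‖xlim i - xlim j‖ < 1 → xlim i = xlim j := by
  obtain ⟨T, hT, hdich⟩ := hx.exists_forall_dist_lt_or_lt ha hpos hmono
    (δ := 1 / 4) (by norm_num)
  have hcont : ∀ i j, ContinuousOn (fun t => ‖x t j - x t i‖) (Ici T) := fun i j => by
    have h1 := (hx.lipschitzOnWith ha).continuousOn.mono (Ici_subset_Ici.2 hT)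
    have h2 := continuousOn_pi.1 h1
    exact ((h2 j).sub (h2 i)).norm
  have hstay : ∀ i j s t, T ≤ s → T ≤ t → ‖x s j - x s i‖ < 1 / 4 → ‖x t j - x t i‖ < 1 / 4 :=
    fun i j s t hs ht => lt_of_dichotomy (hcont i j) (by norm_num) (fun t ht => hdich t ht i j) hs ht
  have hnear : ∀ i j, ‖x T j - x T i‖ < 1 / 4 → Tendsto (fun t => x t j - x t i) atTop (nhds 0) := by
    intro i j hij
    rw [tendsto_zero_iff_norm_tendsto_zero, Metric.tendsto_atTop]
    intro ε hε
    obtain ⟨T', _, hT'⟩ := hx.exists_forall_dist_lt_or_lt ha hpos hmono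
      (δ := min ε (1 / 4)) (by positivity)
    refine ⟨max T T', fun t ht => ?_⟩
    have h1 := hstay i j T t le_rfl (le_of_max_le_left ht) hij
    rw [Real.dist_eq, sub_zero, abs_norm]
    rcases hT' t (le_of_max_le_right ht) i j with h2 | h2
    · exact h2.trans_le (min_le_left _ _)
    · linarith [min_le_right ε (1 / 4)]
  have hfar : ∀ i j, ¬‖x T j - x T i‖ < 1 / 4 → ∀ t, T ≤ t → 3 / 4 < ‖x t j - x t i‖ := by
    intro i j hij t ht
    rcases hdich t ht i j with h1 | h1
    · exact absurd (hstay i j t T ht le_rfl h1) hij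
    · linarith
  have hlim : ∀ i, ∃ l, Tendsto (fun t => x t i) atTop (nhds l) := by
    intro i
    set C : Finset (Fin N) := Finset.univ.filter fun j => ‖x T j - x T i‖ < 1 / 4 with hC
    have hiC : i ∈ C := by simp [hC]
    have hsep : ∀ t, T ≤ t → ∀ j ∈ C, ∀ k ∉ C, 3 / 4 ≤ ‖x t k - x t j‖ := by
      intro t ht j hj k hk
      simp only [hC, Finset.mem_filter, Finset.mem_univ, true_and] at hj hk
      refine (hfar j k (fun hjk => ?_) t ht).le
      have h1 := hfar i k hk T le_rfl
      linarith [norm_sub_le_norm_sub_add_norm_sub (x T k) (x T j) (x T i)]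
    have hS : CauchySeq fun t => ∑ j ∈ C, x t j := by
      rw [Metric.cauchySeq_iff']
      intro ε hε
      obtain ⟨T', hT'0, hT'⟩ := hx.exists_lyapunov_sub_lt ha hmono hε
      refine ⟨max T T', fun t ht => ?_⟩
      rw [dist_eq_norm]
      refine (hx.norm_sum_sub_le ha hmono C (hT.trans (le_max_left _ _)) ht fun τ hτ =>
        hsep τ ((le_max_left _ _).trans hτ.1.le)).trans_lt ?_
      exact hT' _ _ (le_max_right _ _) ht
    obtain ⟨l, hl⟩ := cauchySeq_tendsto_of_complete hS
    have h0 : Tendsto (fun t => ∑ j ∈ C, (x t j - x t i)) atTop (nhds (∑ _j ∈ C, 0)) :=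
      tendsto_finsetSum _ fun j hj => hnear i j (by simpa [hC] using hj)
    refine ⟨_, ((hl.sub h0).const_smul (C.card : ℝ)⁻¹).congr fun t => ?_⟩
    have hcard : (C.card : ℝ) ≠ 0 := Nat.cast_ne_zero.2 (Finset.card_ne_zero_of_mem hiC)
    rw [Finset.sum_sub_distrib, sub_sub_cancel, Finset.sum_const, ← Nat.cast_smul_eq_nsmul ℝ,
      inv_smul_smul₀ hcard]
  choose xlim hxlim using hlim
  refine ⟨xlim, tendsto_pi_nhds.2 hxlim, fun i j hij => ?_⟩
  by_cases h : ‖x T j - x T i‖ < 1 / 4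
  · exact (sub_eq_zero.1 (tendsto_nhds_unique ((hxlim j).sub (hxlim i)) (hnear i j h))).symm
  · exfalso
    have h1 := ((hxlim j).sub (hxlim i)).norm
    rw [norm_sub_rev] at hij
    set δ := min ((1 - ‖xlim j - xlim i‖) / 2) (1 / 4)
    have hδ : 0 < δ := lt_min (by linarith) (by norm_num)
    obtain ⟨T', _, hT'⟩ := hx.exists_forall_dist_lt_or_lt ha hpos hmono hδ
    have h2 : 1 - δ ≤ ‖xlim j - xlim i‖ := by
      refine ge_of_tendsto h1 ?_
      filter_upwards [eventually_ge_atTop (max T T')] with t ht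
      have h3 := hfar i j h t (le_of_max_le_left ht)
      rcases hT' t (le_of_max_le_right ht) i j with h4 | h4
      · linarith [min_le_right ((1 - ‖xlim j - xlim i‖) / 2) (1 / 4)]
      · exact h4.le
    linarith [min_le_left ((1 - ‖xlim j - xlim i‖) / 2) (1 / 4)]

end Asymptotics

/-- Every Krasovsky solution of the metric bounded-confidence model converges to a
cluster point: a configuration in which agents at distance `< 1` coincide. -/
theorem metric_krasovsky_convergence_to_clusters (n N : ℕ) (hn : 1 ≤ n) (hN : 1 ≤ N)
    (a : ℝ → ℝ)
    (ha_lip : ∃ K : NNReal, LipschitzOnWith K a (Set.Ici 0))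
    (ha_nonneg : ∀ r : ℝ, 0 ≤ r → 0 ≤ a r)
    (ha_pos : ∀ r : ℝ, 0 < r → 0 < a r)
    (ha_mono : MonotoneOn a (Set.Ici 0))
    (x : ℝ → St n N)
    (hx : IsKrasovskySolutionOn (fm a) x (Set.Ici 0)) :
    ∃ xlim : St n N, Tendsto x atTop (nhds xlim) ∧
      ∀ i j : Fin N, ‖xlim i - xlim j‖ < 1 → xlim i = xlim j := by
  exact (hx.isLipschitzSolution ha_nonneg ha_mono).exists_tendsto ha_nonneg ha_pos ha_mono
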